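/- arXiv:2003.03673 — 4 statements merged into one kernel-verified Lean document; each statement's English description precedes it below -/
import Mathlib

section
/- Let N ≥ 3 be an integer, x₀ ∈ ℝ^N, d > 0, i ∈ {1,…,N}, and let u, v be harmonic functions on the punctured ball B_d(x₀) \ {x₀} (twice continuously differentiable there with Δu = Δv = 0). Then the quantity Q_{θ,i}(u,v) does not depend on θ for θ ∈ (0, d): for all θ₁, θ₂ ∈ (0, d), Q_{θ₁,i}(u,v) = Q_{θ₂,i}(u,v). -/
open MeasureTheory Metric Real
open scoped RealInnerProductSpace ENNReal

/-- The Euclidean Laplacian `Δu = Σ_{i=1}^N ∂²u/∂x_i²` on `ℝ^N`. -/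
noncomputable def laplacian {N : ℕ} (u : EuclideanSpace ℝ (Fin N) → ℝ)
    (x : EuclideanSpace ℝ (Fin N)) : ℝ :=
  ∑ i : Fin N, fderiv ℝ (fun y => fderiv ℝ u y (EuclideanSpace.single i 1)) x
    (EuclideanSpace.single i 1)

/-- The quadratic boundary form
`P_θ(u,v) = -θ∫_{∂B_θ(x₀)} ⟨∇u,ν⟩⟨∇v,ν⟩ + (θ/2)∫ ⟨∇u,∇v⟩
  + ((2-N)/4)∫ ⟨∇u,ν⟩ v + ((2-N)/4)∫ ⟨∇v,ν⟩ u`,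
where `ν(x) = (x-x₀)/θ` and integrals are over the sphere `∂B_θ(x₀)` with respect to the
`(N-1)`-dimensional Hausdorff measure. -/
noncomputable def Pform {N : ℕ} (x₀ : EuclideanSpace ℝ (Fin N)) (θ : ℝ)
    (u v : EuclideanSpace ℝ (Fin N) → ℝ) : ℝ :=
  -θ * ∫ x in sphere x₀ θ,
      (⟪gradient u x, θ⁻¹ • (x - x₀)⟫) * (⟪gradient v x, θ⁻¹ • (x - x₀)⟫) ∂μH[(N : ℝ) - 1]
  + (θ / 2) * ∫ x in sphere x₀ θ,
      (⟪gradient u x, gradient v x⟫) ∂μH[(N : ℝ) - 1]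
  + ((2 - (N : ℝ)) / 4) * ∫ x in sphere x₀ θ,
      (⟪gradient u x, θ⁻¹ • (x - x₀)⟫) * v x ∂μH[(N : ℝ) - 1]
  + ((2 - (N : ℝ)) / 4) * ∫ x in sphere x₀ θ,
      (⟪gradient v x, θ⁻¹ • (x - x₀)⟫) * u x ∂μH[(N : ℝ) - 1]

/-- The quadratic boundary form
`Q_{θ,i}(u,v) = -∫_{∂B_θ(x₀)} ⟨∇v,ν⟩ ∂u/∂x_i - ∫ ⟨∇u,ν⟩ ∂v/∂x_i + ∫ ⟨∇u,∇v⟩ ν_i`,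
where `ν(x) = (x-x₀)/θ` and integrals are over the sphere `∂B_θ(x₀)` with respect to the
`(N-1)`-dimensional Hausdorff measure. -/
noncomputable def Qform {N : ℕ} (x₀ : EuclideanSpace ℝ (Fin N)) (θ : ℝ) (i : Fin N)
    (u v : EuclideanSpace ℝ (Fin N) → ℝ) : ℝ :=
  -(∫ x in sphere x₀ θ,
      (⟪gradient v x, θ⁻¹ • (x - x₀)⟫) * fderiv ℝ u x (EuclideanSpace.single i 1)
        ∂μH[(N : ℝ) - 1])
  - ∫ x in sphere x₀ θ,
      (⟪gradient u x, θ⁻¹ • (x - x₀)⟫) * fderiv ℝ v x (EuclideanSpace.single i 1)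
        ∂μH[(N : ℝ) - 1]
  + ∫ x in sphere x₀ θ,
      (⟪gradient u x, gradient v x⟫) * ((x - x₀) i / θ) ∂μH[(N : ℝ) - 1]

/-- The `(N-1)`-dimensional surface measure of the unit sphere in `ℝ^N`. -/
noncomputable def omegaN (N : ℕ) : ℝ :=
  (μH[(N : ℝ) - 1] (sphere (0 : EuclideanSpace ℝ (Fin N)) 1)).toReal

/-- The fundamental solution `S_{x₀}(x) = 1/((N-2) ω_N |x-x₀|^{N-2})` of `-Δ` with pole `x₀`. -/
noncomputable def fundSol {N : ℕ} (x₀ x : EuclideanSpace ℝ (Fin N)) : ℝ :=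
  1 / (((N : ℝ) - 2) * omegaN N * ‖x - x₀‖ ^ (N - 2))

/-- `W_{x₀,h}(x) = (x_h - (x₀)_h)/(ω_N |x-x₀|^N)`, the partial derivative of
`S_{x₀}(x)` with respect to the `h`-th coordinate of the pole `x₀`. -/
noncomputable def poleDeriv {N : ℕ} (x₀ : EuclideanSpace ℝ (Fin N)) (h : Fin N)
    (x : EuclideanSpace ℝ (Fin N)) : ℝ :=
  (x h - x₀ h) / (omegaN N * ‖x - x₀‖ ^ N)

/-- A function continuous on a compact set of finite measure is integrable on it. -/
theorem ContinuousOn.integrableOn_of_isCompact_of_measure_lt_top {X : Type*} [TopologicalSpace X]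
    [T2Space X] [MeasurableSpace X] [OpensMeasurableSpace X] [SecondCountableTopology X]
    {μ : Measure X} {K : Set X} {f : X → ℝ} (hf : ContinuousOn f K) (hK : IsCompact K)
    (hμK : μ K < ∞) : IntegrableOn f K μ := by
  obtain ⟨C, hC⟩ := hK.exists_bound_of_continuousOn hf
  exact IntegrableOn.of_bound hμK (hf.aestronglyMeasurable_of_isCompact hK hK.measurableSet) C
    ((ae_restrict_iff' hK.measurableSet).2 (.of_forall hC))

open Topology in
/-- Differentiation under the integral sign over a compact set of finite measure. -/
theorem hasDerivAt_setIntegral_of_isCompact {X : Type*} [TopologicalSpace X] [T2Space X]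
    [MeasurableSpace X] [OpensMeasurableSpace X] [SecondCountableTopology X]
    {μ : Measure X} {K : Set X} (hK : IsCompact K) (hμK : μ K < ∞) {f f' : ℝ → X → ℝ}
    {s : Set ℝ} {t₀ : ℝ} (hs : s ∈ 𝓝 t₀)
    (hf' : ContinuousOn (Function.uncurry f') (s ×ˢ K))
    (hf : ∀ t ∈ s, ContinuousOn (f t) K)
    (hd : ∀ t ∈ s, ∀ x ∈ K, HasDerivAt (f · x) (f' t x) t) :
    HasDerivAt (fun t => ∫ x in K, f t x ∂μ) (∫ x in K, f' t₀ x ∂μ) t₀ := by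
  obtain ⟨c, hc, hcs, hcK⟩ := local_compact_nhds hs
  have ht₀ : t₀ ∈ s := mem_of_mem_nhds hs
  obtain ⟨C, hC⟩ := (hcK.prod hK).exists_bound_of_continuousOn
    (hf'.mono (Set.prod_mono_left hcs))
  have : IsFiniteMeasure (μ.restrict K) := isFiniteMeasure_restrict.2 hμK.ne
  have hft : ContinuousOn (f' t₀) K :=
    hf'.comp (f := fun x => (t₀, x)) (by fun_prop) fun x hx => ⟨ht₀, hx⟩
  refine (hasDerivAt_integral_of_dominated_loc_of_deriv_le (bound := fun _ => C) hc ?_ ?_ ?_ ?_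
    (integrable_const C) ?_).2
  · filter_upwards [hs] with t ht
    exact (hf t ht).aestronglyMeasurable_of_isCompact hK hK.measurableSet
  · exact (hf t₀ ht₀).integrableOn_of_isCompact_of_measure_lt_top hK hμK
  · exact hft.aestronglyMeasurable_of_isCompact hK hK.measurableSet
  · exact (ae_restrict_iff' hK.measurableSet).2
      (.of_forall fun x hx t ht => hC (t, x) ⟨ht, hx⟩)
  · exact (ae_restrict_iff' hK.measurableSet).2
      (.of_forall fun x hx t ht => hd t (hcs ht) x hx)

/-- Radial normalization is `2`-Lipschitz outside the open unit ball. -/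
theorem lipschitzOnWith_inv_norm_smul {E : Type*} [NormedAddCommGroup E] [NormedSpace ℝ E] :
    LipschitzOnWith 2 (fun a : E => ‖a‖⁻¹ • a) {a | 1 ≤ ‖a‖} := by
  refine LipschitzOnWith.of_dist_le_mul fun a ha b hb => ?_
  simp only [Set.mem_ofPred_eq] at ha hb
  have hb0 : 0 < ‖b‖ := by linarith
  have ha0 : 0 < ‖a‖ := by linarith
  have key : ‖a‖⁻¹ • a - ‖b‖⁻¹ • b = ‖a‖⁻¹ • (a - b) + (‖a‖⁻¹ - ‖b‖⁻¹) • b := by module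
  have hsecond : |‖a‖⁻¹ - ‖b‖⁻¹| * ‖b‖ = ‖a‖⁻¹ * |‖b‖ - ‖a‖| := by
    rw [inv_sub_inv ha0.ne' hb0.ne', abs_div, abs_of_pos (mul_pos ha0 hb0)]
    field_simp
  have habs : |‖b‖ - ‖a‖| ≤ ‖a - b‖ := by
    rw [norm_sub_rev]; exact abs_norm_sub_norm_le b a
  have hinv : ‖a‖⁻¹ ≤ 1 := inv_le_one_of_one_le₀ ha
  have hinv0 : 0 ≤ ‖a‖⁻¹ := by positivity
  rw [dist_eq_norm, dist_eq_norm, key]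
  calc _ ≤ ‖a‖⁻¹ * ‖a - b‖ + |‖a‖⁻¹ - ‖b‖⁻¹| * ‖b‖ := by
        refine (norm_add_le _ _).trans ?_
        rw [norm_smul, norm_smul, norm_inv, norm_norm, Real.norm_eq_abs]
    _ ≤ 1 * ‖a - b‖ + 1 * ‖a - b‖ := by rw [hsecond]; gcongr
    _ = _ := by rw [NNReal.coe_ofNat]; ring

open Topology Module in
/-- The unit sphere of an `n + 1`-dimensional inner product space has finite `n`-dimensional
Hausdorff measure. -/
theorem hausdorffMeasure_unitSphere_lt_top {E : Type*} [NormedAddCommGroup E]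
    [InnerProductSpace ℝ E] [FiniteDimensional ℝ E] [MeasurableSpace E] [BorelSpace E] {n : ℕ}
    (hn : finrank ℝ E = n + 1) : μH[(n : ℝ)] (sphere (0 : E) 1) < ∞ := by
  refine (isCompact_sphere (0 : E) 1).measure_lt_top_of_nhdsWithin fun x hx => ?_
  have hx1 : ‖x‖ = 1 := by simpa using hx
  have hx0 : x ≠ 0 := by rintro rfl; simp at hx1
  have : Fact (finrank ℝ E = n + 1) := ⟨hn⟩
  let W := (Submodule.span ℝ {x})ᗮ
  have hW : finrank ℝ W = n := Submodule.finrank_orthogonal_span_singleton hx0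
  have horth : ∀ w : W, ⟪x, (w : E)⟫ = 0 := fun w =>
    Submodule.mem_orthogonal_singleton_iff_inner_right.1 w.2
  have hnorm : ∀ w : W, 1 ≤ ‖x + (w : E)‖ := fun w => by
    have h := norm_add_sq_eq_norm_sq_add_norm_sq_real (horth w)
    rw [hx1] at h
    nlinarith [norm_nonneg (x + (w : E)), mul_self_nonneg ‖(w : E)‖]
  let g : W → E := fun w => ‖x + (w : E)‖⁻¹ • (x + (w : E))
  have hg : LipschitzWith 2 g := by
    have h1 : LipschitzWith 1 (fun w : W => x + (w : E)) :=
      LipschitzWith.of_dist_le_mul fun a b => by simp [Subtype.dist_eq]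
    have := lipschitzOnWith_inv_norm_smul.comp h1.lipschitzOnWith (s := Set.univ)
      (fun w _ => hnorm w)
    simpa [g, Function.comp_def, lipschitzOnWith_univ] using this
  have hball : μH[(n : ℝ)] (closedBall (0 : W) 2) < ∞ := by
    rw [← hW]
    exact (isCompact_closedBall (0 : W) 2).measure_lt_top
  have himage : μH[(n : ℝ)] (g '' closedBall 0 2) < ∞ :=
    (hg.hausdorffMeasure_image_le n.cast_nonneg _).trans_lt
      (ENNReal.mul_lt_top (by simp) hball)
  refine ⟨g '' closedBall 0 2, ?_, himage⟩
  have hopen : IsOpen {y : E | 1 / 2 < ⟪x, y⟫} := isOpen_lt (by fun_prop) (by fun_prop)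
  have hxmem : x ∈ {y : E | 1 / 2 < ⟪x, y⟫} := by
    simp only [Set.mem_ofPred_eq, real_inner_self_eq_norm_sq, hx1]; norm_num
  filter_upwards [mem_nhdsWithin_of_mem_nhds (hopen.mem_nhds hxmem), self_mem_nhdsWithin]
    with y hy hyS
  have hy1 : ‖y‖ = 1 := by simpa using hyS
  have hy : 1 / 2 < ⟪x, y⟫ := hy
  set c := ⟪x, y⟫ with hc
  have hc0 : 0 < c := by linarith
  have hmem : c⁻¹ • y - x ∈ W := by
    rw [Submodule.mem_orthogonal_singleton_iff_inner_right, inner_sub_right, inner_smul_right,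
      real_inner_self_eq_norm_sq, hx1, ← hc]
    field_simp; norm_num
  have hadd : x + (c⁻¹ • y - x) = c⁻¹ • y := by abel
  refine ⟨⟨_, hmem⟩, ?_, ?_⟩
  · have h := norm_add_sq_eq_norm_sq_add_norm_sq_real (horth ⟨_, hmem⟩)
    have hcinv : c⁻¹ < 2 := by rw [inv_lt_comm₀ hc0 (by norm_num)]; linarith
    have hcinv0 : 0 < c⁻¹ := inv_pos.2 hc0
    simp only [hadd, norm_smul, hx1, hy1, norm_inv, Real.norm_eq_abs, abs_of_pos hc0] at h
    rw [mem_closedBall_zero_iff, Submodule.coe_norm]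
    nlinarith [norm_nonneg (c⁻¹ • y - x)]
  · simp only [g, hadd, norm_smul, hy1, norm_inv, Real.norm_eq_abs, abs_of_pos hc0, smul_smul]
    field_simp
    simp

open Module in
theorem hausdorffMeasure_sphere_lt_top {E : Type*} [NormedAddCommGroup E]
    [InnerProductSpace ℝ E] [FiniteDimensional ℝ E] [MeasurableSpace E] [BorelSpace E] {n : ℕ}
    (hn : finrank ℝ E = n + 1) (x₀ : E) {θ : ℝ} (hθ : 0 < θ) :
    μH[(n : ℝ)] (sphere x₀ θ) < ∞ := by
  have hlip : LipschitzWith ‖θ‖₊ (fun x : E => x₀ + θ • x) :=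
    LipschitzWith.of_dist_le_mul fun a b => by simp [dist_smul₀]
  refine (measure_mono fun x hx => ?_).trans_lt
    ((hlip.hausdorffMeasure_image_le n.cast_nonneg (sphere 0 1)).trans_lt
      (ENNReal.mul_lt_top (by simp) (hausdorffMeasure_unitSphere_lt_top hn)))
  refine ⟨θ⁻¹ • (x - x₀), ?_, by simp [hθ.ne']⟩
  rw [mem_sphere_zero_iff_norm, norm_smul, mem_sphere_iff_norm.1 hx, norm_inv, Real.norm_eq_abs,
    abs_of_pos hθ, inv_mul_cancel₀ hθ.ne']

open Pointwise in
/-- The integral over a sphere of radius `θ`, written as an integral over the unit sphere. -/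
theorem setIntegral_sphere_eq_unitSphere {E : Type*} [NormedAddCommGroup E]
    [NormedSpace ℝ E] [MeasurableSpace E] [BorelSpace E] (n : ℕ)
    (x₀ : E) {θ : ℝ} (hθ : 0 < θ) (f : E → ℝ) :
    ∫ x in sphere x₀ θ, f x ∂μH[(n : ℝ)]
      = θ ^ n * ∫ x in sphere (0 : E) 1, f (x₀ + θ • x) ∂μH[(n : ℝ)] := by
  let e : E ≃ₜ E := (Homeomorph.smulOfNeZero θ hθ.ne').trans (Homeomorph.addLeft x₀)
  have he : ∀ x, e x = x₀ + θ • x := fun x => rfl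
  have hpre : e ⁻¹' sphere x₀ θ = sphere 0 1 := by
    ext x
    simp [he, norm_smul, abs_of_pos hθ, hθ.ne']
  have hmap : (μH[(n : ℝ)] : Measure E)
      = ENNReal.ofReal (θ ^ n) • Measure.map e μH[(n : ℝ)] := by
    ext s hs
    rw [Measure.smul_apply, e.measurableEmbedding.map_apply]
    have himg : s = (IsometryEquiv.addLeft x₀) '' (θ • (e ⁻¹' s)) := by
      conv_lhs => rw [← e.image_preimage s]
      rw [← Set.image_smul, Set.image_image]
      rfl
    conv_lhs => rw [himg]
    rw [IsometryEquiv.hausdorffMeasure_image, Measure.hausdorffMeasure_smul₀ n.cast_nonneg hθ.ne']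
    have : ((‖θ‖₊ ^ (n : ℝ) : NNReal) : ENNReal) = ENNReal.ofReal (θ ^ n) := by
      rw [NNReal.rpow_natCast, ENNReal.ofReal_pow hθ.le, ENNReal.coe_pow,
        Real.nnnorm_of_nonneg hθ.le, ENNReal.ofReal_eq_coe_nnreal hθ.le]
    rw [← this]; rfl
  conv_lhs => rw [hmap]
  rw [Measure.restrict_smul, integral_smul_measure, ENNReal.toReal_ofReal (by positivity),
    e.measurableEmbedding.setIntegral_map, hpre, smul_eq_mul]
  rfl

open Topology in
/-- Derivatives along an infinitesimal rotation integrate to zero over the unit sphere. -/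
theorem setIntegral_unitSphere_fderiv_skewAdjoint {E : Type*} [NormedAddCommGroup E]
    [InnerProductSpace ℝ E] [FiniteDimensional ℝ E] [MeasurableSpace E] [BorelSpace E] {δ : ℝ}
    (hfin : μH[δ] (sphere (0 : E) 1) < ∞) {A : E →L[ℝ] E} (hA : A ∈ skewAdjoint (E →L[ℝ] E))
    {U : Set E} (hU : IsOpen U) (hSU : sphere 0 1 ⊆ U) {g : E → ℝ} (hg : ContDiffOn ℝ 1 g U) :
    ∫ x in sphere (0 : E) 1, fderiv ℝ g x (A x) ∂μH[δ] = 0 := by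
  let R : ℝ → E →L[ℝ] E := fun t => NormedSpace.exp (t • A)
  let _ : NormedAlgebra ℚ (E →L[ℝ] E) := NormedAlgebra.restrictScalars ℚ ℝ _
  have hR : ∀ t, R t ∈ unitary (E →L[ℝ] E) := fun t =>
    NormedSpace.exp_mem_unitary_of_mem_skewAdjoint (skewAdjoint.smul_mem t hA)
  have hRd : ∀ t, HasDerivAt R (A * R t) t := fun t => hasDerivAt_exp_smul_const' A t
  have hRc : Continuous R := continuous_iff_continuousAt.2 fun t => (hRd t).continuousAt
  have hR0 : R 0 = 1 := by simp [R]
  have hRS : ∀ t, ∀ x ∈ sphere (0 : E) 1, R t x ∈ sphere (0 : E) 1 := fun t x hx => by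
    have := Unitary.norm_map ⟨R t, hR t⟩ x
    simp only [mem_sphere_zero_iff_norm] at hx ⊢
    exact this.trans hx
  have hconst : ∀ t, ∫ x in sphere (0 : E) 1, g (R t x) ∂μH[δ]
      = ∫ x in sphere (0 : E) 1, g x ∂μH[δ] := fun t => by
    let e := Unitary.linearIsometryEquiv ⟨R t, hR t⟩
    have hpre : e ⁻¹' sphere (0 : E) 1 = sphere 0 1 := by ext x; simp
    have := (e.toIsometryEquiv.measurePreserving_hausdorffMeasure δ).setIntegral_preimage_emb
      e.toHomeomorph.measurableEmbedding g (sphere 0 1)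
    rw [← this]
    change _ = ∫ x in e ⁻¹' sphere 0 1, _ ∂_
    rw [hpre]
    rfl
  have hderiv : HasDerivAt (fun t => ∫ x in sphere (0 : E) 1, g (R t x) ∂μH[δ])
      (∫ x in sphere (0 : E) 1, fderiv ℝ g (R 0 x) (A (R 0 x)) ∂μH[δ]) 0 := by
    have hRx : Continuous fun p : ℝ × E => R p.1 p.2 :=
      (hRc.comp continuous_fst).clm_apply continuous_snd
    refine hasDerivAt_setIntegral_of_isCompact (isCompact_sphere _ _) hfin
      (f := fun t x => g (R t x)) (f' := fun t x => fderiv ℝ g (R t x) (A (R t x)))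
      (s := Set.univ) Filter.univ_mem ?_ ?_ ?_
    · refine ContinuousOn.clm_apply
        (f := fun p : ℝ × E => fderiv ℝ g (R p.1 p.2)) ?_ (A.continuous.comp hRx).continuousOn
      exact (hg.continuousOn_fderiv_of_isOpen hU le_rfl).comp hRx.continuousOn
        fun p hp => hSU (hRS _ _ hp.2)
    · exact fun t _ => hg.continuousOn.comp (R t).continuous.continuousOn
        fun x hx => hSU (hRS _ _ hx)
    · intro t _ x hx
      have hdg := ((hg.contDiffAt (hU.mem_nhds (hSU (hRS t x hx)))).differentiableAt
        one_ne_zero).hasFDerivAt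
      exact hdg.comp_hasDerivAt t
        ((hRd t).clm_apply (hasDerivAt_const t x) |>.congr_deriv (by simp))
  simp only [hconst, hR0] at hderiv
  exact (hderiv.unique (hasDerivAt_const _ _))

/-- The generator `x ↦ x_j e_k - x_k e_j` of the rotations of the `(j, k)`-coordinate plane. -/
noncomputable def planeRotationGenerator {N : ℕ} (j k : Fin N) :
    EuclideanSpace ℝ (Fin N) →L[ℝ] EuclideanSpace ℝ (Fin N) :=
  (EuclideanSpace.proj j : EuclideanSpace ℝ (Fin N) →L[ℝ] ℝ).smulRight
      (EuclideanSpace.single k (1 : ℝ))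
    - (EuclideanSpace.proj k : EuclideanSpace ℝ (Fin N) →L[ℝ] ℝ).smulRight
      (EuclideanSpace.single j (1 : ℝ))

theorem planeRotationGenerator_apply {N : ℕ} (j k : Fin N) (x : EuclideanSpace ℝ (Fin N)) :
    planeRotationGenerator j k x
      = x j • EuclideanSpace.single k (1 : ℝ) - x k • EuclideanSpace.single j (1 : ℝ) := rfl

theorem planeRotationGenerator_mem_skewAdjoint {N : ℕ} (j k : Fin N) :
    planeRotationGenerator j k
      ∈ skewAdjoint (EuclideanSpace ℝ (Fin N) →L[ℝ] EuclideanSpace ℝ (Fin N)) := by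
  rw [skewAdjoint.mem_iff]
  refine ContinuousLinearMap.ext fun x => ext_inner_right ℝ fun y => ?_
  rw [ContinuousLinearMap.star_eq_adjoint, ContinuousLinearMap.adjoint_inner_left]
  simp only [neg_apply, planeRotationGenerator_apply, inner_sub_right,
    inner_sub_left, inner_neg_left, inner_smul_left, inner_smul_right,
    EuclideanSpace.inner_single_left, EuclideanSpace.inner_single_right]
  simp
  ring

/-- The divergence theorem on the unit sphere, for a vector field with components `G k`. -/
theorem setIntegral_unitSphere_divergence {N : ℕ} {δ : ℝ}
    (hfin : μH[δ] (sphere (0 : EuclideanSpace ℝ (Fin N)) 1) < ∞)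
    {U : Set (EuclideanSpace ℝ (Fin N))} (hU : IsOpen U) (hSU : sphere 0 1 ⊆ U)
    {G : Fin N → EuclideanSpace ℝ (Fin N) → ℝ} (hG : ∀ k, ContDiffOn ℝ 1 (G k) U) :
    ∫ x in sphere (0 : EuclideanSpace ℝ (Fin N)) 1,
      (∑ k, fderiv ℝ (G k) x (EuclideanSpace.single k 1) - ((N : ℝ) - 1) * ∑ k, G k x * x k
        - ∑ k, fderiv ℝ (G k) x x * x k) ∂μH[δ] = 0 := by
  have hg : ∀ j k, ContDiffOn ℝ 1 (fun x : EuclideanSpace ℝ (Fin N) => x j * G k x) U :=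
    fun j k => ContDiffOn.mul (by fun_prop) (hG k)
  have hint : ∀ j k, IntegrableOn (fun x => fderiv ℝ
      (fun x : EuclideanSpace ℝ (Fin N) => x j * G k x) x (planeRotationGenerator j k x))
      (sphere 0 1) μH[δ] := fun j k => by
    have hc : ContinuousOn (fun x => fderiv ℝ
      (fun x : EuclideanSpace ℝ (Fin N) => x j * G k x) x (planeRotationGenerator j k x))
      (sphere 0 1) :=
      (((hg j k).continuousOn_fderiv_of_isOpen hU le_rfl).mono hSU).clm_apply
        (planeRotationGenerator j k).continuous.continuousOn
    exact hc.integrableOn_of_isCompact_of_measure_lt_top (isCompact_sphere _ _) hfin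
  have hsum : ∫ x in sphere (0 : EuclideanSpace ℝ (Fin N)) 1, ∑ j, ∑ k, fderiv ℝ
      (fun x : EuclideanSpace ℝ (Fin N) => x j * G k x) x (planeRotationGenerator j k x)
      ∂μH[δ] = 0 := by
    rw [integral_finsetSum _ fun j _ => integrable_finsetSum _ fun k _ => hint j k]
    refine Finset.sum_eq_zero fun j _ => ?_
    rw [integral_finsetSum _ fun k _ => hint j k]
    exact Finset.sum_eq_zero fun k _ => setIntegral_unitSphere_fderiv_skewAdjoint hfin
      (planeRotationGenerator_mem_skewAdjoint j k) hU hSU (hg j k)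
  rw [← hsum]
  refine setIntegral_congr_fun isClosed_sphere.measurableSet fun x hx => ?_
  have hx1 : ∑ j, x j * x j = 1 := by
    have h := EuclideanSpace.real_norm_sq_eq x
    rw [mem_sphere_zero_iff_norm.1 hx] at h
    simpa [pow_two] using h.symm
  have hterm : ∀ j k, fderiv ℝ (fun x : EuclideanSpace ℝ (Fin N) => x j * G k x) x
      (planeRotationGenerator j k x)
      = (if j = k then G k x * x k else 0) - G k x * x k
        + x j * x j * fderiv ℝ (G k) x (EuclideanSpace.single k 1)
        - x j * fderiv ℝ (G k) x (EuclideanSpace.single j 1) * x k := fun j k => by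
    have hd := (((hG k).contDiffAt (hU.mem_nhds (hSU hx))).differentiableAt
      one_ne_zero).hasFDerivAt
    have hp : HasFDerivAt (fun x : EuclideanSpace ℝ (Fin N) => x j)
      (EuclideanSpace.proj j : EuclideanSpace ℝ (Fin N) →L[ℝ] ℝ) x :=
      (EuclideanSpace.proj j : EuclideanSpace ℝ (Fin N) →L[ℝ] ℝ).hasFDerivAt
    rw [(hp.fun_mul hd).fderiv]
    simp only [planeRotationGenerator_apply, add_apply, smul_apply, map_sub,
      map_smul, smul_eq_mul]
    by_cases h : j = k
    · subst h; simp; ring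
    · simp [h]; ring
  have hlin : ∀ k, fderiv ℝ (G k) x x
      = ∑ j, x j * fderiv ℝ (G k) x (EuclideanSpace.single j 1) := fun k => by
    have h := (EuclideanSpace.basisFun (Fin N) ℝ).sum_repr x
    conv_lhs => enter [2]; rw [← h]
    simp
  simp only [hterm, hlin]
  rw [Finset.sum_comm]
  simp only [Finset.sum_sub_distrib, Finset.sum_add_distrib, Finset.sum_ite_eq',
    Finset.mem_univ, if_true, Finset.sum_const, Finset.card_univ, Fintype.card_fin, nsmul_eq_mul,
    ← Finset.sum_mul, ← Finset.mul_sum, hx1]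
  ring

/-- The flux of a divergence-free field through a sphere does not depend on the radius. -/
theorem sphere_flux_independent_of_radius {N : ℕ} (hN : 1 ≤ N) (x₀ : EuclideanSpace ℝ (Fin N))
    {d : ℝ} {F : Fin N → EuclideanSpace ℝ (Fin N) → ℝ}
    (hF : ∀ k, ContDiffOn ℝ 1 (F k) (ball x₀ d \ {x₀}))
    (hdiv : ∀ x ∈ ball x₀ d \ {x₀}, ∑ k, fderiv ℝ (F k) x (EuclideanSpace.single k 1) = 0)
    {θ₁ θ₂ : ℝ} (hθ₁ : θ₁ ∈ Set.Ioo 0 d) (hθ₂ : θ₂ ∈ Set.Ioo 0 d) :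
    ∫ x in sphere x₀ θ₁, ∑ k, F k x * ((x - x₀) k / θ₁) ∂μH[(N : ℝ) - 1]
      = ∫ x in sphere x₀ θ₂, ∑ k, F k x * ((x - x₀) k / θ₂) ∂μH[(N : ℝ) - 1] := by
  obtain ⟨n, rfl⟩ : ∃ n, N = n + 1 := ⟨N - 1, by omega⟩
  have hcast : ((n + 1 : ℕ) : ℝ) - 1 = n := by push_cast; ring
  rw [hcast]
  let U : Set (EuclideanSpace ℝ (Fin (n + 1))) := ball x₀ d \ {x₀}
  have hU : IsOpen U := isOpen_ball.sdiff isClosed_singleton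
  have hfin : μH[(n : ℝ)] (sphere (0 : EuclideanSpace ℝ (Fin (n + 1))) 1) < ∞ :=
    hausdorffMeasure_unitSphere_lt_top (by simp)
  have hmem : ∀ t ∈ Set.Ioo 0 d, ∀ x ∈ sphere (0 : EuclideanSpace ℝ (Fin (n + 1))) 1,
      x₀ + t • x ∈ U := fun t ht x hx => by
    have hx1 := mem_sphere_zero_iff_norm.1 hx
    have hx0 : x ≠ 0 := by rintro rfl; simp at hx1
    refine ⟨by simpa [norm_smul, hx1, abs_of_pos ht.1] using ht.2, ?_⟩
    simpa [hx0] using ht.1.ne'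
  have hdF : ∀ k, ∀ y ∈ U, HasFDerivAt (F k) (fderiv ℝ (F k) y) y := fun k y hy =>
    (((hF k).contDiffAt (hU.mem_nhds hy)).differentiableAt one_ne_zero).hasFDerivAt
  let Φ : ℝ → ℝ := fun t => t ^ n * ∫ x in sphere (0 : EuclideanSpace ℝ (Fin (n + 1))) 1,
    ∑ k, F k (x₀ + t • x) * x k ∂μH[(n : ℝ)]
  have hflux : ∀ t ∈ Set.Ioo 0 d,
      ∫ x in sphere x₀ t, ∑ k, F k x * ((x - x₀) k / t) ∂μH[(n : ℝ)] = Φ t := fun t ht => by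
    rw [setIntegral_sphere_eq_unitSphere n x₀ ht.1]
    simp [Φ, ht.1.ne']
  have hcont : ∀ t ∈ Set.Ioo 0 d, ContinuousOn
      (fun x : EuclideanSpace ℝ (Fin (n + 1)) => ∑ k, F k (x₀ + t • x) * x k) (sphere 0 1) :=
    fun t ht => continuousOn_finsetSum _ fun k _ => ContinuousOn.mul
      ((hF k).continuousOn.comp (by fun_prop) (hmem t ht)) (by fun_prop)
  have hcont' : ContinuousOn (Function.uncurry fun (t : ℝ) (x : EuclideanSpace ℝ (Fin (n + 1))) =>
      ∑ k, fderiv ℝ (F k) (x₀ + t • x) x * x k) (Set.Ioo 0 d ×ˢ sphere 0 1) := by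
    refine continuousOn_finsetSum _ fun k _ => ContinuousOn.mul ?_ (by fun_prop)
    refine ContinuousOn.clm_apply (f := fun p : ℝ × EuclideanSpace ℝ (Fin (n + 1)) =>
      fderiv ℝ (F k) (x₀ + p.1 • p.2)) ?_ (by fun_prop)
    exact ((hF k).continuousOn_fderiv_of_isOpen hU le_rfl).comp (by fun_prop)
      fun p hp => hmem p.1 hp.1 p.2 hp.2
  have hΦ : ∀ t ∈ Set.Ioo 0 d, HasDerivAt Φ 0 t := fun t ht => by
    have hI := hasDerivAt_setIntegral_of_isCompact (isCompact_sphere _ _) hfin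
      (isOpen_Ioo.mem_nhds ht) hcont' hcont fun s hs x hx => by
        refine HasDerivAt.fun_sum fun k _ => HasDerivAt.mul_const ?_ _
        refine (hdF k _ (hmem s hs x hx)).comp_hasDerivAt s ?_
        simpa using ((hasDerivAt_id s).smul_const x).const_add x₀
    refine ((hasDerivAt_pow n t).mul hI).congr_deriv ?_
    let V : Set (EuclideanSpace ℝ (Fin (n + 1))) := (fun x => x₀ + t • x) ⁻¹' U
    have hV : IsOpen V := hU.preimage (by fun_prop)
    have hG : ∀ k, ContDiffOn ℝ 1 (fun x => F k (x₀ + t • x)) V := fun k =>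
      (hF k).comp (by fun_prop) fun x hx => hx
    have hdG : ∀ k, ∀ x ∈ sphere (0 : EuclideanSpace ℝ (Fin (n + 1))) 1, ∀ w,
        fderiv ℝ (fun x => F k (x₀ + t • x)) x w = t * fderiv ℝ (F k) (x₀ + t • x) w :=
      fun k x hx w => by
        have h := (hdF k _ (hmem t ht x hx)).comp x
          (((hasFDerivAt_id x).fun_const_smul t).const_add x₀)
        rw [show (fun x => F k (x₀ + t • x)) = F k ∘ fun x => x₀ + t • id x from rfl, h.fderiv]
        simp
    have hdivG := setIntegral_unitSphere_divergence hfin hV (fun x hx => hmem t ht x hx) hG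
    have hzero : ∫ x in sphere (0 : EuclideanSpace ℝ (Fin (n + 1))) 1,
        ((n : ℝ) * ∑ k, F k (x₀ + t • x) * x k
          + t * ∑ k, fderiv ℝ (F k) (x₀ + t • x) x * x k) ∂μH[(n : ℝ)] = 0 := by
      rw [← neg_eq_zero, ← integral_neg, ← hdivG]
      refine setIntegral_congr_fun isClosed_sphere.measurableSet fun x hx => ?_
      have h0 := hdiv _ (hmem t ht x hx)
      simp only [hdG _ x hx, mul_assoc, ← Finset.mul_sum, h0, hcast]
      ring
    have hi := (hcont t ht).integrableOn_of_isCompact_of_measure_lt_top (isCompact_sphere _ _) hfin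
    have hi' : IntegrableOn (fun x : EuclideanSpace ℝ (Fin (n + 1)) =>
        ∑ k, fderiv ℝ (F k) (x₀ + t • x) x * x k) (sphere 0 1) μH[(n : ℝ)] :=
      (hcont'.comp (f := fun x => (t, x)) (by fun_prop)
        fun x hx => ⟨ht, hx⟩).integrableOn_of_isCompact_of_measure_lt_top (isCompact_sphere _ _) hfin
    rw [integral_add (hi.const_mul _) (hi'.const_mul t), integral_const_mul,
      integral_const_mul] at hzero
    have hpow : t * (n * t ^ (n - 1)) = t ^ n * n := by
      cases n with
      | zero => simp
      | succ m => rw [Nat.add_sub_cancel]; ring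
    refine (mul_eq_zero.1 ?_).resolve_left ht.1.ne'
    rw [mul_add, ← mul_assoc, hpow]
    linear_combination t ^ n * hzero
  rw [hflux _ hθ₁, hflux _ hθ₂]
  exact isOpen_Ioo.is_const_of_deriv_eq_zero isPreconnected_Ioo
    (fun t ht => (hΦ t ht).differentiableAt.differentiableWithinAt)
    (fun t ht => (hΦ t ht).deriv) hθ₁ hθ₂

/-- The components of the field `-∂ᵢu ∇v - ∂ᵢv ∇u + ⟨∇u, ∇v⟩ eᵢ`, whose flux is `Qform`. -/
noncomputable def stressField {N : ℕ} (i : Fin N) (u v : EuclideanSpace ℝ (Fin N) → ℝ)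
    (k : Fin N) (x : EuclideanSpace ℝ (Fin N)) : ℝ :=
  -(fderiv ℝ u x (EuclideanSpace.single i 1) * fderiv ℝ v x (EuclideanSpace.single k 1))
    - fderiv ℝ v x (EuclideanSpace.single i 1) * fderiv ℝ u x (EuclideanSpace.single k 1)
    + (∑ j, fderiv ℝ u x (EuclideanSpace.single j 1) * fderiv ℝ v x (EuclideanSpace.single j 1))
      * (if k = i then 1 else 0)

section

variable {N : ℕ} {U : Set (EuclideanSpace ℝ (Fin N))} {u v : EuclideanSpace ℝ (Fin N) → ℝ}

theorem ContDiffOn.fderiv_apply_single (hU : IsOpen U) (hu : ContDiffOn ℝ 2 u U) (k : Fin N) :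
    ContDiffOn ℝ 1 (fun y => fderiv ℝ u y (EuclideanSpace.single k 1)) U :=
  (hu.fderiv_of_isOpen hU (by norm_num)).clm_apply contDiffOn_const

theorem ContDiffOn.fderiv_fderiv_single_comm (hU : IsOpen U) (hu : ContDiffOn ℝ 2 u U)
    {x : EuclideanSpace ℝ (Fin N)} (hx : x ∈ U) (j k : Fin N) :
    fderiv ℝ (fun y => fderiv ℝ u y (EuclideanSpace.single j 1)) x (EuclideanSpace.single k 1)
      = fderiv ℝ (fun y => fderiv ℝ u y (EuclideanSpace.single k 1)) x
        (EuclideanSpace.single j 1) := by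
  have hsymm : IsSymmSndFDerivAt ℝ u x :=
    (hu.contDiffAt (hU.mem_nhds hx)).isSymmSndFDerivAt (by simp)
  have hd : DifferentiableAt ℝ (fderiv ℝ u) x :=
    ((hu.fderiv_of_isOpen hU (m := 1) (by norm_num)).contDiffAt
      (hU.mem_nhds hx)).differentiableAt one_ne_zero
  have happly : ∀ w z : EuclideanSpace ℝ (Fin N),
      fderiv ℝ (fun y => fderiv ℝ u y w) x z = fderiv ℝ (fderiv ℝ u) x z w := fun w z => by
    rw [(hd.hasFDerivAt.clm_apply (hasFDerivAt_const w x)).fderiv]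
    simp
  rw [happly, happly]
  exact hsymm _ _

theorem contDiffOn_stressField (hU : IsOpen U) (hu : ContDiffOn ℝ 2 u U)
    (hv : ContDiffOn ℝ 2 v U) (i k : Fin N) : ContDiffOn ℝ 1 (stressField i u v k) U := by
  have hu' := hu.fderiv_apply_single hU
  have hv' := hv.fderiv_apply_single hU
  exact ((((hu' i).mul (hv' k)).neg.sub ((hv' i).mul (hu' k))).add
    ((ContDiffOn.sum fun j _ => (hu' j).mul (hv' j)).mul contDiffOn_const))

/-- The stress field of two harmonic functions is divergence-free. -/
theorem divergence_stressField (hU : IsOpen U) (hu : ContDiffOn ℝ 2 u U)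
    (hv : ContDiffOn ℝ 2 v U) (i : Fin N) {x : EuclideanSpace ℝ (Fin N)} (hx : x ∈ U)
    (hu0 : laplacian u x = 0) (hv0 : laplacian v x = 0) :
    ∑ k, fderiv ℝ (stressField i u v k) x (EuclideanSpace.single k 1) = 0 := by
  have hdu : ∀ k, HasFDerivAt (fun y => fderiv ℝ u y (EuclideanSpace.single k 1)) _ x := fun k =>
    (((hu.fderiv_apply_single hU k).contDiffAt (hU.mem_nhds hx)).differentiableAt
      one_ne_zero).hasFDerivAt
  have hdv : ∀ k, HasFDerivAt (fun y => fderiv ℝ v y (EuclideanSpace.single k 1)) _ x := fun k =>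
    (((hv.fderiv_apply_single hU k).contDiffAt (hU.mem_nhds hx)).differentiableAt
      one_ne_zero).hasFDerivAt
  have hterm : ∀ k, fderiv ℝ (stressField i u v k) x (EuclideanSpace.single k 1) = _ := fun k =>
    DFunLike.congr_fun (((((hdu i).fun_mul (hdv k)).fun_neg.fun_sub
      ((hdv i).fun_mul (hdu k))).fun_add ((HasFDerivAt.fun_sum fun j _ =>
        (hdu j).fun_mul (hdv j)).mul_const (if k = i then (1 : ℝ) else 0))).fderiv) _
  simp only [laplacian] at hu0 hv0
  simp only [hterm, add_apply, sub_apply, neg_apply, smul_apply, smul_eq_mul, sum_apply,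
    ite_mul, one_mul, zero_mul, Finset.sum_add_distrib, Finset.sum_sub_distrib,
    Finset.sum_neg_distrib, Finset.sum_ite_eq', Finset.mem_univ, if_true,
    ← Finset.mul_sum, hu0, hv0]
  have hsu := fun k => hu.fderiv_fderiv_single_comm hU hx i k
  have hsv := fun k => hv.fderiv_fderiv_single_comm hU hx i k
  simp only [hsu, hsv]
  ring

end

open InnerProductSpace in
theorem real_inner_gradient_gradient {N : ℕ} (u v : EuclideanSpace ℝ (Fin N) → ℝ)
    (x : EuclideanSpace ℝ (Fin N)) : ⟪gradient u x, gradient v x⟫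
      = ∑ j, fderiv ℝ u x (EuclideanSpace.single j 1) * fderiv ℝ v x (EuclideanSpace.single j 1) := by
  rw [← (EuclideanSpace.basisFun (Fin N) ℝ).sum_inner_mul_inner]
  simp [inner_gradient_left, inner_gradient_right]

theorem real_inner_gradient_smul_sub {N : ℕ} (u : EuclideanSpace ℝ (Fin N) → ℝ) (θ : ℝ)
    (x x₀ : EuclideanSpace ℝ (Fin N)) : ⟪gradient u x, θ⁻¹ • (x - x₀)⟫
      = ∑ k, fderiv ℝ u x (EuclideanSpace.single k 1) * ((x - x₀) k / θ) := by
  rw [← (EuclideanSpace.basisFun (Fin N) ℝ).sum_inner_mul_inner]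
  simp [inner_gradient_left, inner_smul_right, EuclideanSpace.inner_single_left, div_eq_inv_mul]

/-- `Qform` is the flux of the stress field. -/
theorem Qform_eq_flux_stressField {N : ℕ} {U : Set (EuclideanSpace ℝ (Fin N))}
    {u v : EuclideanSpace ℝ (Fin N) → ℝ} (hU : IsOpen U) (hu : ContDiffOn ℝ 2 u U)
    (hv : ContDiffOn ℝ 2 v U) (x₀ : EuclideanSpace ℝ (Fin N)) (θ : ℝ) (hSU : sphere x₀ θ ⊆ U)
    (hfin : μH[(N : ℝ) - 1] (sphere x₀ θ) < ∞) (i : Fin N) :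
    Qform x₀ θ i u v = ∫ x in sphere x₀ θ, ∑ k, stressField i u v k x * ((x - x₀) k / θ)
      ∂μH[(N : ℝ) - 1] := by
  have hcu := fun k => ((hu.fderiv_apply_single hU k).continuousOn).mono hSU
  have hcv := fun k => ((hv.fderiv_apply_single hU k).continuousOn).mono hSU
  have hν : ∀ k, ContinuousOn (fun x : EuclideanSpace ℝ (Fin N) => (x - x₀) k / θ)
      (sphere x₀ θ) := fun k => by fun_prop
  have hflux : ∀ {p q : Fin N → EuclideanSpace ℝ (Fin N) → ℝ},
      (∀ k, ContinuousOn (p k) (sphere x₀ θ)) → (∀ k, ContinuousOn (q k) (sphere x₀ θ)) →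
      IntegrableOn (fun x => (∑ k, p k x * ((x - x₀) k / θ)) * q i x) (sphere x₀ θ)
        μH[(N : ℝ) - 1] := fun hp hq =>
    ((continuousOn_finsetSum _ fun k _ => (hp k).mul (hν k)).mul
      (hq i)).integrableOn_of_isCompact_of_measure_lt_top (isCompact_sphere _ _) hfin
  have hdot : IntegrableOn (fun x => (∑ j, fderiv ℝ u x (EuclideanSpace.single j 1)
      * fderiv ℝ v x (EuclideanSpace.single j 1)) * ((x - x₀) i / θ)) (sphere x₀ θ)
      μH[(N : ℝ) - 1] :=
    ((continuousOn_finsetSum _ fun k _ => (hcu k).mul (hcv k)).mul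
      (hν i)).integrableOn_of_isCompact_of_measure_lt_top (isCompact_sphere _ _) hfin
  have hneg := (hflux hcv hcu).fun_neg
  simp only [Qform, real_inner_gradient_gradient, real_inner_gradient_smul_sub]
  rw [← integral_neg, ← integral_sub hneg (hflux hcu hcv),
    ← integral_add (hneg.fun_sub (hflux hcu hcv)) hdot]
  congr 1 with x
  simp only [stressField, add_mul, sub_mul, neg_mul, Finset.sum_add_distrib,
    Finset.sum_sub_distrib, Finset.sum_neg_distrib, mul_assoc, ← Finset.mul_sum, ite_mul, one_mul,
    zero_mul, Finset.sum_ite_eq', Finset.mem_univ, if_true]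
  ring

/-- If `u` and `v` are harmonic on the punctured ball `B_d(x₀) \ {x₀}`, then the quadratic
form `Q_{θ,i}(u,v)` is independent of `θ ∈ (0, d)`. -/
theorem Qform_independent_of_radius {N : ℕ} (hN : 3 ≤ N)
    (x₀ : EuclideanSpace ℝ (Fin N)) (d : ℝ) (hd : 0 < d) (i : Fin N)
    (u v : EuclideanSpace ℝ (Fin N) → ℝ)
    (hu : ContDiffOn ℝ 2 u (ball x₀ d \ {x₀}))
    (hv : ContDiffOn ℝ 2 v (ball x₀ d \ {x₀}))
    (hu0 : ∀ x ∈ ball x₀ d \ {x₀}, laplacian u x = 0)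
    (hv0 : ∀ x ∈ ball x₀ d \ {x₀}, laplacian v x = 0) :
    ∀ θ₁ ∈ Set.Ioo (0 : ℝ) d, ∀ θ₂ ∈ Set.Ioo (0 : ℝ) d,
      Qform x₀ θ₁ i u v = Qform x₀ θ₂ i u v := by
  intro θ₁ hθ₁ θ₂ hθ₂
  have hU : IsOpen (ball x₀ d \ {x₀}) := isOpen_ball.sdiff isClosed_singleton
  have hcast : ((N - 1 : ℕ) : ℝ) = (N : ℝ) - 1 := Nat.cast_pred (by omega)
  have hQ : ∀ θ ∈ Set.Ioo (0 : ℝ) d, Qform x₀ θ i u v = ∫ x in sphere x₀ θ,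
      ∑ k, stressField i u v k x * ((x - x₀) k / θ) ∂μH[(N : ℝ) - 1] := fun θ hθ =>
    Qform_eq_flux_stressField hU hu hv x₀ θ
      (fun x hx => ⟨sphere_subset_ball hθ.2 hx, ne_of_mem_sphere hx hθ.1.ne'⟩)
      (hcast ▸ hausdorffMeasure_sphere_lt_top (by simp; omega) x₀ hθ.1) i
  rw [hQ θ₁ hθ₁, hQ θ₂ hθ₂]
  exact sphere_flux_independent_of_radius (by omega) x₀
    (fun k => contDiffOn_stressField hU hu hv i k)
    (fun x hx => divergence_stressField hU hu hv i hx (hu0 x hx) (hv0 x hx)) hθ₁ hθ₂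
end

section
/- Let N ≥ 3 be an integer, x₀ ∈ ℝ^N, h ∈ {1,…,N}, S_{x₀}(x) := 1/((N−2)ω_N |x−x₀|^{N−2}), and W_{x₀,h}(x) := (x_h − (x₀)_h)/(ω_N |x−x₀|^N) (the partial derivative of S_{x₀}(x) with respect to the h-th coordinate of the pole x₀). Then for every θ > 0, P_θ(S_{x₀}, W_{x₀,h}) = 0. -/
open MeasureTheory Metric Real
open scoped RealInnerProductSpace ENNReal

/-- If `u (c - y) = s * u y` for all `y`, then `∇u (c - x) = -s ∇u x`. -/
theorem gradient_const_sub_of_comp_eq_smul {E : Type*} [NormedAddCommGroup E]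
    [InnerProductSpace ℝ E] [CompleteSpace E] {u : E → ℝ} {c : E} {s : ℝ}
    (hs : s * s = 1) (hu : ∀ y, u (c - y) = s * u y) (x : E) :
    gradient u (c - x) = -(s • gradient u x) := by
  have key : fderiv ℝ u x = -(s • fderiv ℝ u (c - x)) := by
    have hcomp : u = s • ((fun z => u (c + z)) ∘ ContinuousLinearEquiv.neg ℝ) := by
      funext y
      simp [← sub_eq_add_neg, hu, ← mul_assoc, hs]
    conv_lhs => rw [hcomp]
    rw [fderiv_const_smul_field, Pi.smul_apply, ContinuousLinearEquiv.comp_right_fderiv,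
      fderiv_comp_add_left]
    ext y
    simp [← sub_eq_add_neg]
  rw [gradient, gradient, key, map_neg, map_smul, smul_neg, neg_neg, smul_smul, hs, one_smul]

/-- A function that is odd with respect to the reflection about `x₀` has zero integral over every
sphere centered at `x₀`. -/
theorem setIntegral_sphere_hausdorffMeasure_eq_zero_of_odd {E : Type*} [NormedAddCommGroup E]
    [MeasurableSpace E] [BorelSpace E] (d : ℝ) (x₀ : E) (θ : ℝ) {F : E → ℝ}
    (hF : ∀ x, F (x₀ + x₀ - x) = -F x) :
    ∫ x in sphere x₀ θ, F x ∂μH[d] = 0 := by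
  let σ : E ≃ᵢ E := IsometryEquiv.subLeft (x₀ + x₀)
  have hpre : σ ⁻¹' sphere x₀ θ = sphere x₀ θ := by
    ext x
    simp [σ, norm_sub_rev]
  have hintegral := (σ.measurePreserving_hausdorffMeasure d).setIntegral_preimage_emb
    σ.toHomeomorph.measurableEmbedding F (sphere x₀ θ)
  rw [hpre] at hintegral
  have hσ : ∀ x, F (σ x) = -F x := hF
  simp only [hσ, integral_neg] at hintegral
  linarith

theorem fundSol_reflection {N : ℕ} (x₀ x : EuclideanSpace ℝ (Fin N)) :
    fundSol x₀ (x₀ + x₀ - x) = fundSol x₀ x := by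
  have hx : x₀ + x₀ - x - x₀ = -(x - x₀) := by abel
  rw [fundSol, fundSol, hx, norm_neg]

theorem poleDeriv_reflection {N : ℕ} (x₀ : EuclideanSpace ℝ (Fin N)) (h : Fin N)
    (x : EuclideanSpace ℝ (Fin N)) :
    poleDeriv x₀ h (x₀ + x₀ - x) = -poleDeriv x₀ h x := by
  have hx : x₀ + x₀ - x - x₀ = -(x - x₀) := by abel
  rw [poleDeriv, poleDeriv, hx, norm_neg, ← neg_div]
  simp only [PiLp.sub_apply, PiLp.add_apply]
  ring

/-- `P_θ(S_{x₀}, W_{x₀,h}) = 0` for every `θ > 0`, where `S_{x₀}` is the fundamental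
solution of `-Δ` with pole `x₀` and `W_{x₀,h}` is its derivative in the `h`-th coordinate
of the pole. -/
theorem Pform_fundSol_poleDeriv {N : ℕ} (hN : 3 ≤ N)
    (x₀ : EuclideanSpace ℝ (Fin N)) (h : Fin N) (θ : ℝ) (hθ : 0 < θ) :
    Pform x₀ θ (fundSol x₀) (poleDeriv x₀ h) = 0 := by
  have hν (x : EuclideanSpace ℝ (Fin N)) : x₀ + x₀ - x - x₀ = -(x - x₀) := by abel
  have hgu (x : EuclideanSpace ℝ (Fin N)) :
      gradient (fundSol x₀) (x₀ + x₀ - x) = -gradient (fundSol x₀) x := by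
    simpa using gradient_const_sub_of_comp_eq_smul (s := 1) (by norm_num)
      (fun y => by rw [fundSol_reflection, one_mul]) x
  have hgv (x : EuclideanSpace ℝ (Fin N)) :
      gradient (poleDeriv x₀ h) (x₀ + x₀ - x) = gradient (poleDeriv x₀ h) x := by
    simpa using gradient_const_sub_of_comp_eq_smul (s := -1) (by norm_num)
      (fun y => by rw [poleDeriv_reflection, neg_one_mul]) x
  unfold Pform
  rw [setIntegral_sphere_hausdorffMeasure_eq_zero_of_odd,
    setIntegral_sphere_hausdorffMeasure_eq_zero_of_odd,
    setIntegral_sphere_hausdorffMeasure_eq_zero_of_odd,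
    setIntegral_sphere_hausdorffMeasure_eq_zero_of_odd]
  · ring
  all_goals
    intro x
    simp only [hgu, hgv, hν, fundSol_reflection, poleDeriv_reflection, smul_neg, inner_neg_left,
      inner_neg_right, neg_mul, mul_neg, neg_neg]
end

section
/- Let N ≥ 3 be an integer, x₀ ∈ ℝ^N, i, h ∈ {1,…,N}, S_{x₀}(x) := 1/((N−2)ω_N |x−x₀|^{N−2}), and W_{x₀,h}(x) := (x_h − (x₀)_h)/(ω_N |x−x₀|^N) (the partial derivative of S_{x₀}(x) with respect to the h-th coordinate of the pole x₀). Then for every θ > 0, Q_{θ,i}(S_{x₀}, W_{x₀,h}) = 0. -/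
open MeasureTheory Metric Real
open scoped RealInnerProductSpace ENNReal

/-- The Hausdorff measure on `∂B_θ(x₀)` is invariant under the linear isometries
about the centre. -/
theorem measurePreserving_isometry_sphere {N : ℕ} (d : ℝ) (x₀ : EuclideanSpace ℝ (Fin N)) (θ : ℝ)
    (L : EuclideanSpace ℝ (Fin N) ≃ₗᵢ[ℝ] EuclideanSpace ℝ (Fin N)) :
    MeasurePreserving (fun x => L (x - x₀) + x₀)
      ((μH[d] : Measure (EuclideanSpace ℝ (Fin N))).restrict (sphere x₀ θ))
      (μH[d].restrict (sphere x₀ θ)) := by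
  let φ : EuclideanSpace ℝ (Fin N) ≃ᵢ EuclideanSpace ℝ (Fin N) :=
    ((IsometryEquiv.subRight x₀).trans L.toIsometryEquiv).trans (IsometryEquiv.addRight x₀)
  have hφ : ∀ x, φ x = L (x - x₀) + x₀ := fun x => rfl
  have hpre : φ ⁻¹' sphere x₀ θ = sphere x₀ θ := by
    ext x
    rw [Set.mem_preimage, hφ, mem_sphere_iff_norm, mem_sphere_iff_norm, add_sub_cancel_right,
      L.norm_map]
  have h := (φ.measurePreserving_hausdorffMeasure d).restrict_preimage
    (isClosed_sphere (x := x₀) (ε := θ)).measurableSet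
  rwa [hpre] at h

theorem measurableEmbedding_isometry_sphere {N : ℕ} (x₀ : EuclideanSpace ℝ (Fin N))
    (L : EuclideanSpace ℝ (Fin N) ≃ₗᵢ[ℝ] EuclideanSpace ℝ (Fin N)) :
    MeasurableEmbedding (fun x => L (x - x₀) + x₀) :=
  (((IsometryEquiv.subRight x₀).trans L.toIsometryEquiv).trans
    (IsometryEquiv.addRight x₀)).toHomeomorph.measurableEmbedding

theorem setIntegral_sphere_comp_isometry {N : ℕ} (d : ℝ) (x₀ : EuclideanSpace ℝ (Fin N)) (θ : ℝ)
    (L : EuclideanSpace ℝ (Fin N) ≃ₗᵢ[ℝ] EuclideanSpace ℝ (Fin N))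
    (F : EuclideanSpace ℝ (Fin N) → ℝ) :
    ∫ x in sphere x₀ θ, F (L (x - x₀)) ∂μH[d] = ∫ x in sphere x₀ θ, F (x - x₀) ∂μH[d] := by
  simpa using (measurePreserving_isometry_sphere d x₀ θ L).integral_comp
    (measurableEmbedding_isometry_sphere x₀ L) (fun x => F (x - x₀))

theorem integrableOn_sphere_comp_isometry {N : ℕ} (d : ℝ) (x₀ : EuclideanSpace ℝ (Fin N)) (θ : ℝ)
    (L : EuclideanSpace ℝ (Fin N) ≃ₗᵢ[ℝ] EuclideanSpace ℝ (Fin N))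
    {F : EuclideanSpace ℝ (Fin N) → ℝ}
    (hF : IntegrableOn (fun x => F (x - x₀)) (sphere x₀ θ) μH[d]) :
    IntegrableOn (fun x => F (L (x - x₀))) (sphere x₀ θ) μH[d] := by
  have h := (measurePreserving_isometry_sphere d x₀ θ L).integrable_comp_of_integrable hF
  simpa [Function.comp_def, IntegrableOn] using h

/-- The trace-free quadratic polynomial `δ_{ih} - N y_i y_h / θ²` has vanishing integral over the
sphere of radius `θ`. -/
theorem setIntegral_sphere_traceFree_eq_zero {N : ℕ} (d : ℝ) (x₀ : EuclideanSpace ℝ (Fin N))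
    (i h : Fin N) {θ : ℝ} (hθ : 0 < θ) :
    ∫ x in sphere x₀ θ,
      ((if i = h then 1 else 0) - N * ((x - x₀) i * (x - x₀) h) / θ ^ 2) ∂μH[d] = 0 := by
  have hN : (N : ℝ) ≠ 0 := Nat.cast_ne_zero.mpr i.pos.ne'
  rcases eq_or_ne i h with rfl | hih
  · let F : Fin N → EuclideanSpace ℝ (Fin N) → ℝ := fun j y => 1 - N * (y j * y j) / θ ^ 2
    let L : Fin N → EuclideanSpace ℝ (Fin N) ≃ₗᵢ[ℝ] EuclideanSpace ℝ (Fin N) := fun j =>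
      LinearIsometryEquiv.piLpCongrLeft 2 ℝ ℝ (Equiv.swap i j)
    have hL : ∀ j y, F j y = F i (L j y) := fun j y => by
      simp [F, L, LinearIsometryEquiv.piLpCongrLeft_apply, Equiv.piCongrLeft'_apply]
    suffices ∫ x in sphere x₀ θ, F i (x - x₀) ∂μH[d] = 0 by simpa [F] using this
    by_cases hint : IntegrableOn (fun x => F i (x - x₀)) (sphere x₀ θ) μH[d]
    · have hsum : ∑ j, ∫ x in sphere x₀ θ, F j (x - x₀) ∂μH[d] = 0 := by
        have hintj : ∀ j, IntegrableOn (fun x => F j (x - x₀)) (sphere x₀ θ) μH[d] := fun j => by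
          simpa only [hL j] using integrableOn_sphere_comp_isometry d x₀ θ (L j) hint
        rw [← integral_finsetSum _ fun j _ => hintj j]
        refine setIntegral_eq_zero_of_forall_eq_zero fun x hx => ?_
        have hx' : ∑ j, (x - x₀) j * (x - x₀) j = θ ^ 2 := by
          rw [← mem_sphere_iff_norm.mp hx, EuclideanSpace.real_norm_sq_eq]
          simp only [pow_two]
        simp only [F, Finset.sum_sub_distrib, ← Finset.sum_div, ← Finset.mul_sum, hx']
        simp [hθ.ne']
      have heq : ∀ j, ∫ x in sphere x₀ θ, F j (x - x₀) ∂μH[d]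
          = ∫ x in sphere x₀ θ, F i (x - x₀) ∂μH[d] := fun j => by
        simpa only [hL j] using setIntegral_sphere_comp_isometry d x₀ θ (L j) (F i)
      simpa [heq, hN] using hsum
    · exact integral_undef hint
  · let L : EuclideanSpace ℝ (Fin N) ≃ₗᵢ[ℝ] EuclideanSpace ℝ (Fin N) :=
      LinearIsometryEquiv.piLpCongrRight 2 fun j =>
        if j = h then LinearIsometryEquiv.neg ℝ else LinearIsometryEquiv.refl ℝ ℝ
    have key := setIntegral_sphere_comp_isometry d x₀ θ L
      fun y => (0 : ℝ) - N * (y i * y h) / θ ^ 2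
    have hLi : ∀ y, L y i = y i := fun y => by
      simp [L, LinearIsometryEquiv.piLpCongrRight_apply, hih]
    have hLh : ∀ y, L y h = -y h := fun y => by
      simp [L, LinearIsometryEquiv.piLpCongrRight_apply]
    simp only [hLi, hLh, mul_neg, neg_div, zero_sub, neg_neg] at key
    rw [integral_neg] at key
    simp only [hih, if_false, zero_sub, integral_neg]
    linarith

theorem hasFDerivAt_norm_sub {E : Type*} [NormedAddCommGroup E] [InnerProductSpace ℝ E]
    {x₀ x : E} (hx : x - x₀ ≠ 0) :
    HasFDerivAt (fun y => ‖y - x₀‖) (‖x - x₀‖⁻¹ • innerSL ℝ (x - x₀)) x := by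
  have h := ((hasFDerivAt_id (𝕜 := ℝ) x).sub_const x₀).norm_sq.sqrt
    (pow_ne_zero 2 (norm_ne_zero_iff.mpr hx))
  simp only [id, Real.sqrt_sq (norm_nonneg _)] at h
  refine h.congr_fderiv ?_
  ext v
  have := norm_ne_zero_iff.mpr hx
  simp
  field_simp

theorem hasFDerivAt_inv_norm_sub_pow {E : Type*} [NormedAddCommGroup E] [InnerProductSpace ℝ E]
    {x₀ x : E} (hx : x - x₀ ≠ 0) (k : ℕ) :
    HasFDerivAt (fun y => (‖y - x₀‖ ^ k)⁻¹) (-(k / ‖x - x₀‖ ^ (k + 2)) • innerSL ℝ (x - x₀)) x := by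
  have hr := norm_ne_zero_iff.mpr hx
  have h := ((hasDerivAt_pow k ‖x - x₀‖).inv (pow_ne_zero _ hr)).comp_hasFDerivAt x
    (hasFDerivAt_norm_sub hx)
  refine h.congr_fderiv ?_
  rw [smul_smul]
  congr 1
  rcases k with _ | k
  · simp
  · simp only [Nat.add_sub_cancel]
    field_simp
    ring

theorem hasGradientAt_fundSol {N : ℕ} (hN : 3 ≤ N) {x₀ x : EuclideanSpace ℝ (Fin N)}
    (hx : x - x₀ ≠ 0) :
    HasGradientAt (fundSol x₀) (-((omegaN N)⁻¹ / ‖x - x₀‖ ^ N) • (x - x₀)) x := by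
  obtain ⟨k, rfl⟩ : ∃ k, N = k + 3 := ⟨N - 3, by omega⟩
  have hr := norm_ne_zero_iff.mpr hx
  have h := (hasFDerivAt_inv_norm_sub_pow hx (k + 1)).const_mul
    ((((k + 3 : ℕ) : ℝ) - 2)⁻¹ * (omegaN (k + 3))⁻¹)
  have hfun : fundSol x₀ = fun y => ((((k + 3 : ℕ) : ℝ) - 2)⁻¹ * (omegaN (k + 3))⁻¹) *
      (‖y - x₀‖ ^ (k + 1))⁻¹ := by
    ext y
    simp [fundSol]
    ring
  rw [hasGradientAt_iff_hasFDerivAt, hfun]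
  refine h.congr_fderiv ?_
  ext v
  have hk : (k : ℝ) + 3 - 2 ≠ 0 := by
    have : (0 : ℝ) ≤ k := k.cast_nonneg
    linarith
  simp
  field_simp
  ring

theorem hasGradientAt_poleDeriv {N : ℕ} {x₀ x : EuclideanSpace ℝ (Fin N)} (h : Fin N)
    (hx : x - x₀ ≠ 0) :
    HasGradientAt (poleDeriv x₀ h)
      (((omegaN N)⁻¹ / ‖x - x₀‖ ^ N) • EuclideanSpace.single h 1
        - ((omegaN N)⁻¹ * N * (x - x₀) h / ‖x - x₀‖ ^ (N + 2)) • (x - x₀)) x := by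
  have hr := norm_ne_zero_iff.mpr hx
  have hc : HasFDerivAt (fun y : EuclideanSpace ℝ (Fin N) => y h - x₀ h)
      (EuclideanSpace.proj h : EuclideanSpace ℝ (Fin N) →L[ℝ] ℝ) x :=
    (EuclideanSpace.proj h : EuclideanSpace ℝ (Fin N) →L[ℝ] ℝ).hasFDerivAt.sub_const _
  have hd := (hc.mul (hasFDerivAt_inv_norm_sub_pow hx N)).const_mul
    (omegaN N)⁻¹
  have hfun : poleDeriv x₀ h = fun y => (omegaN N)⁻¹ *
      ((y h - x₀ h) * (‖y - x₀‖ ^ N)⁻¹) := by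
    ext y
    simp [poleDeriv, div_eq_mul_inv]
    ring
  rw [hasGradientAt_iff_hasFDerivAt, hfun]
  refine hd.congr_fderiv ?_
  ext v
  simp [EuclideanSpace.inner_single_left]
  field_simp
  ring

/-- `Q_{θ,i}(S_{x₀}, W_{x₀,h}) = 0` for every `θ > 0`, where `S_{x₀}` is the fundamental
solution of `-Δ` with pole `x₀` and `W_{x₀,h}` is its derivative in the `h`-th coordinate
of the pole. -/
theorem Qform_fundSol_poleDeriv {N : ℕ} (hN : 3 ≤ N)
    (x₀ : EuclideanSpace ℝ (Fin N)) (i h : Fin N) (θ : ℝ) (hθ : 0 < θ) :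
    Qform x₀ θ i (fundSol x₀) (poleDeriv x₀ h) = 0 := by
  have hS : MeasurableSet (sphere x₀ θ) := isClosed_sphere.measurableSet
  have hx : ∀ x ∈ sphere x₀ θ, ‖x - x₀‖ = θ := fun x hx => mem_sphere_iff_norm.mp hx
  have hx0 : ∀ x ∈ sphere x₀ θ, x - x₀ ≠ 0 := fun x hxs =>
    norm_ne_zero_iff.mp ((hx x hxs).trans_ne hθ.ne')
  have hu := fun x hxs => hasGradientAt_fundSol hN (hx0 x hxs)
  have hv := fun x hxs => hasGradientAt_poleDeriv h (hx0 x hxs)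
  have hself : ∀ x ∈ sphere x₀ θ, ⟪x - x₀, x - x₀⟫ = θ ^ 2 := fun x hxs => by
    rw [real_inner_self_eq_norm_sq, hx x hxs]
  have hcancel : ∫ x in sphere x₀ θ, (⟪gradient (poleDeriv x₀ h) x, θ⁻¹ • (x - x₀)⟫) *
        fderiv ℝ (fundSol x₀) x (EuclideanSpace.single i 1) ∂μH[(N : ℝ) - 1]
      = ∫ x in sphere x₀ θ, (⟪gradient (fundSol x₀) x, gradient (poleDeriv x₀ h) x⟫) *
        ((x - x₀) i / θ) ∂μH[(N : ℝ) - 1] := by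
    refine setIntegral_congr_fun hS fun x hxs => ?_
    simp only [(hu x hxs).gradient, (hv x hxs).gradient, (hu x hxs).hasFDerivAt.fderiv,
      InnerProductSpace.toDual_apply_apply, hx x hxs]
    have hy := hself x hxs
    generalize x - x₀ = y at hy ⊢
    simp only [inner_sub_left, inner_sub_right, real_inner_smul_left, real_inner_smul_right, hy,
      EuclideanSpace.inner_single_left, EuclideanSpace.inner_single_right, map_one, one_mul,
      conj_trivial, PiLp.smul_apply, smul_eq_mul]
    ring
  have hzero : ∫ x in sphere x₀ θ, (⟪gradient (fundSol x₀) x, θ⁻¹ • (x - x₀)⟫) *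
        fderiv ℝ (poleDeriv x₀ h) x (EuclideanSpace.single i 1) ∂μH[(N : ℝ) - 1] = 0 := by
    trans ∫ x in sphere x₀ θ, -((omegaN N)⁻¹ ^ 2 * θ / θ ^ (2 * N)) *
      ((if i = h then 1 else 0) - N * ((x - x₀) i * (x - x₀) h) / θ ^ 2) ∂μH[(N : ℝ) - 1]
    · refine setIntegral_congr_fun hS fun x hxs => ?_
      simp only [(hu x hxs).gradient, (hv x hxs).hasFDerivAt.fderiv,
        InnerProductSpace.toDual_apply_apply, hx x hxs]
      have hy := hself x hxs
      generalize x - x₀ = y at hy ⊢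
      simp only [inner_sub_left, real_inner_smul_left, real_inner_smul_right, hy,
        EuclideanSpace.inner_single_right, one_mul, conj_trivial, PiLp.smul_apply,
        smul_eq_mul, PiLp.single_apply]
      generalize (omegaN N)⁻¹ = c
      field_simp
      ring
    · rw [integral_const_mul, setIntegral_sphere_traceFree_eq_zero _ _ _ _ hθ, mul_zero]
  rw [Qform, hcancel, hzero]
  ring
end

section
/- Let N ≥ 3 be an integer, x₀ ∈ ℝ^N, i ∈ {1,…,N}, S_{x₀}(x) := 1/((N−2)ω_N |x−x₀|^{N−2}), and let Φ be a real function that is continuously differentiable on an open neighborhood of x₀. Then lim_{θ→0⁺} Q_{θ,i}(S_{x₀}, Φ) = (∂Φ/∂x_i)(x₀). -/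
open MeasureTheory Metric Real
open scoped RealInnerProductSpace ENNReal

/-- The unit sphere of `ℝⁿ⁺¹` has finite `n`-dimensional Hausdorff measure: it is covered by the
central projections of the faces of the cube `[-1, 1]ⁿ⁺¹`. -/
theorem hausdorffMeasure_unitSphere_lt_top_s15 (n : ℕ) :
    μH[(n : ℝ)] (sphere (0 : EuclideanSpace ℝ (Fin (n + 1))) 1) < ∞ := by
  let face : Fin (n + 1) → SignType → (Fin n → ℝ) → EuclideanSpace ℝ (Fin (n + 1)) :=
    fun k s w => WithLp.toLp 2 (k.insertNth (s : ℝ) w)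
  let proj : Fin (n + 1) → SignType → (Fin n → ℝ) → EuclideanSpace ℝ (Fin (n + 1)) :=
    fun k s w => ‖face k s w‖⁻¹ • face k s w
  have face_ne : ∀ k s w, s ≠ 0 → face k s w ≠ 0 := by
    intro k s w hs h
    have := congrArg (fun v : EuclideanSpace ℝ (Fin (n + 1)) => v k) h
    rcases s with _ | _ | _ <;> simp_all [face]
  have face_contDiff : ∀ k s, ContDiff ℝ 1 (face k s) := by
    intro k s
    rw [contDiff_euclidean]
    intro j
    refine Fin.succAboveCases k ?_ (fun j => ?_) j
    · simpa [face] using contDiff_const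
    · simpa [face] using contDiff_apply ℝ ℝ j
  let cube : Set (Fin n → ℝ) := Set.Icc (-1) 1
  have image_lt : ∀ k s, s ≠ 0 → μH[(n : ℝ)] (proj k s '' cube) < ∞ := by
    intro k s hs
    have hC : ContDiff ℝ 1 (proj k s) :=
      (((face_contDiff k s).norm ℝ fun w => face_ne k s w hs).inv fun w =>
        norm_ne_zero_iff.2 (face_ne k s w hs)).smul (face_contDiff k s)
    obtain ⟨K, hK⟩ := hC.contDiffOn.exists_lipschitzOnWith one_ne_zero (convex_Icc _ _)
      (isCompact_Icc : IsCompact cube)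
    refine (hK.hausdorffMeasure_image_le n.cast_nonneg).trans_lt ?_
    have hvol : (μH[(n : ℝ)] : Measure (Fin n → ℝ)) = volume := by
      simpa using hausdorffMeasure_pi_real (ι := Fin n)
    rw [hvol]
    exact ENNReal.mul_lt_top (by simp) isCompact_Icc.measure_lt_top
  have cover : sphere (0 : EuclideanSpace ℝ (Fin (n + 1))) 1 ⊆
      ⋃ k, (proj k 1 '' cube ∪ proj k (-1) '' cube) := by
    intro x hx
    have hx1 : ‖x‖ = 1 := by simpa using hx
    obtain ⟨k, -, hk⟩ := Finset.exists_max_image Finset.univ (fun j => |x j|) Finset.univ_nonempty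
    have hxk : x k ≠ 0 := by
      intro h0
      have : x = 0 := by
        ext j
        have := hk j (Finset.mem_univ j)
        simpa [h0] using this
      simp [this] at hx1
    have key : ∀ s : SignType, (s : ℝ) * |x k| = x k → x ∈ proj k s '' cube := by
      intro s hs
      have hpos : 0 < |x k| := abs_pos.2 hxk
      refine ⟨fun j => |x k|⁻¹ * x (k.succAbove j), ?_, ?_⟩
      · have hb : ∀ j, |(|x k|⁻¹ * x (k.succAbove j))| ≤ 1 := by
          intro j
          rw [abs_mul, abs_inv, abs_abs, inv_mul_le_iff₀ hpos, mul_one]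
          exact hk _ (Finset.mem_univ _)
        exact ⟨fun j => (abs_le.1 (hb j)).1, fun j => (abs_le.1 (hb j)).2⟩
      · have hface : face k s (fun j => |x k|⁻¹ * x (k.succAbove j)) = |x k|⁻¹ • x := by
          ext j
          refine Fin.succAboveCases k ?_ (fun j => ?_) j
          · simp only [face, Fin.insertNth_apply_same, PiLp.smul_apply, smul_eq_mul]
            rw [eq_inv_mul_iff_mul_eq₀ hpos.ne', mul_comm, hs]
          · simp [face]
        simp only [proj, hface, norm_smul, hx1, smul_smul]
        simp [hpos.ne']
    refine Set.mem_iUnion.2 ⟨k, ?_⟩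
    rcases lt_or_gt_of_ne hxk with h | h
    · exact Or.inr (key (-1) (by simp [abs_of_neg h]))
    · exact Or.inl (key 1 (by simp [abs_of_pos h]))
  refine (measure_mono cover).trans_lt ((measure_iUnion_fintype_le _ _).trans_lt ?_)
  refine ENNReal.sum_lt_top.2 fun k _ => (measure_union_le _ _).trans_lt ?_
  exact ENNReal.add_lt_top.2 ⟨image_lt k 1 (by decide), image_lt k (-1) (by decide)⟩

/-- The unit sphere of `ℝⁿ⁺¹` has positive `n`-dimensional Hausdorff measure: its projection to
`ℝⁿ` contains the unit ball. -/
theorem hausdorffMeasure_unitSphere_pos (n : ℕ) :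
    0 < μH[(n : ℝ)] (sphere (0 : EuclideanSpace ℝ (Fin (n + 1))) 1) := by
  let drop : EuclideanSpace ℝ (Fin (n + 1)) → Fin n → ℝ := fun x j => x j.succ
  have drop_lip : LipschitzWith 1 drop := by
    refine LipschitzWith.of_dist_le_mul fun x y => ?_
    rw [NNReal.coe_one, one_mul]
    refine (dist_pi_le_iff dist_nonneg).2 fun j => ?_
    rw [dist_eq_norm, dist_eq_norm]
    exact PiLp.norm_apply_le (x - y) j.succ
  let ball' : Set (Fin n → ℝ) := {w | ∑ j, w j ^ 2 < 1}
  have hsub : ball' ⊆ drop '' sphere 0 1 := by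
    intro w hw
    have hw' : ∑ j, w j ^ 2 < 1 := hw
    refine ⟨WithLp.toLp 2 (Fin.cons (√(1 - ∑ j, w j ^ 2)) w), ?_, ?_⟩
    · rw [mem_sphere_zero_iff_norm, EuclideanSpace.norm_eq, Fin.sum_univ_succ]
      simp [Real.sq_sqrt (sub_nonneg.2 hw'.le)]
    · ext j
      simp [drop]
  have hopen : IsOpen ball' := isOpen_lt (by fun_prop) continuous_const
  have hvol : (μH[(n : ℝ)] : Measure (Fin n → ℝ)) = volume := by
    simpa using hausdorffMeasure_pi_real (ι := Fin n)
  have hpos : 0 < μH[(n : ℝ)] ball' := by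
    rw [hvol]
    exact hopen.measure_pos volume ⟨0, by simp [ball']⟩
  have := drop_lip.hausdorffMeasure_image_le n.cast_nonneg (sphere 0 1)
  simp only [ENNReal.coe_one, ENNReal.one_rpow, one_mul] at this
  exact hpos.trans_le ((measure_mono hsub).trans this)

theorem omegaN_pos {N : ℕ} (hN : 1 ≤ N) : 0 < omegaN N := by
  obtain ⟨n, rfl⟩ := Nat.exists_eq_add_of_le' hN
  have hcast : ((n + 1 : ℕ) : ℝ) - 1 = n := by push_cast; ring
  rw [omegaN, hcast]
  exact ENNReal.toReal_pos (hausdorffMeasure_unitSphere_pos n).ne'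
    (hausdorffMeasure_unitSphere_lt_top_s15 n).ne

open scoped Pointwise in
theorem hausdorffMeasure_sphere {N : ℕ} (hN : 1 ≤ N) (x₀ : EuclideanSpace ℝ (Fin N)) {θ : ℝ}
    (hθ : 0 < θ) :
    μH[(N : ℝ) - 1] (sphere x₀ θ) = ENNReal.ofReal (θ ^ (N - 1) * omegaN N) := by
  obtain ⟨n, rfl⟩ := Nat.exists_eq_add_of_le' hN
  have hcast : ((n + 1 : ℕ) : ℝ) - 1 = n := by push_cast; ring
  have himage : x₀ +ᵥ θ • sphere (0 : EuclideanSpace ℝ (Fin (n + 1))) 1 = sphere x₀ θ := by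
    rw [smul_sphere' hθ.ne', smul_zero, vadd_sphere, vadd_eq_add, add_zero, mul_one,
      Real.norm_of_nonneg hθ.le]
  rw [omegaN, hcast, ← himage, hausdorffMeasure_vadd _ (Or.inl n.cast_nonneg),
    Measure.hausdorffMeasure_smul₀ n.cast_nonneg hθ.ne', ENNReal.ofReal_mul (by positivity),
    ENNReal.ofReal_toReal (hausdorffMeasure_unitSphere_lt_top_s15 n).ne, NNReal.rpow_natCast,
    ENNReal.smul_def, smul_eq_mul, ENNReal.coe_pow, add_tsub_cancel_right,
    ENNReal.ofReal_pow hθ.le, ← Real.enorm_eq_ofReal hθ.le, enorm_eq_nnnorm]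

theorem hasFDerivAt_fundSol {N : ℕ} (hN : 3 ≤ N) {x₀ x : EuclideanSpace ℝ (Fin N)}
    (hx : x ≠ x₀) :
    HasFDerivAt (fundSol x₀) (-(omegaN N * ‖x - x₀‖ ^ N)⁻¹ • innerSL ℝ (x - x₀)) x := by
  obtain ⟨n, rfl⟩ := Nat.exists_eq_add_of_le' hN
  have hr : ‖x - x₀‖ ≠ 0 := norm_ne_zero_iff.2 (sub_ne_zero.2 hx)
  have hω : omegaN (n + 3) ≠ 0 := (omegaN_pos (by omega)).ne'
  have hn : (n : ℝ) + 1 ≠ 0 := by positivity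
  have hnorm : HasFDerivAt (fun y => ‖y - x₀‖) (‖x - x₀‖⁻¹ • innerSL ℝ (x - x₀)) x := by
    have h := (((hasFDerivAt_id x).sub_const x₀).norm_sq).sqrt (by simpa using hr)
    simp only [id, Real.sqrt_sq (norm_nonneg _)] at h
    refine h.congr_fderiv ?_
    ext v
    simp
    field_simp
  have hd : HasDerivAt (fun r : ℝ => 1 / (((n + 3 : ℕ) - 2 : ℝ) * omegaN (n + 3) * r ^ (n + 1)))
      (-(omegaN (n + 3) * ‖x - x₀‖ ^ (n + 2))⁻¹) ‖x - x₀‖ := by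
    have hc : ((n + 3 : ℕ) - 2 : ℝ) = n + 1 := by push_cast; ring
    rw [hc]
    have h := (((hasDerivAt_pow (n + 1) ‖x - x₀‖).const_mul ((n + 1) * omegaN (n + 3))).inv
      (by positivity))
    simp only [one_div]
    refine h.congr_deriv ?_
    push_cast
    field_simp
    ring
  refine (hd.comp_hasFDerivAt x hnorm).congr_fderiv ?_
  rw [smul_smul]
  congr 1
  field_simp
  ring

/-- On every sphere around the pole, `Q_{θ,i}(S_{x₀}, v)` is the mean of `∂v/∂x_i`. -/
theorem Qform_fundSol_eq_mean {N : ℕ} (hN : 3 ≤ N) (x₀ : EuclideanSpace ℝ (Fin N)) {θ : ℝ}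
    (hθ : 0 < θ) (i : Fin N) (v : EuclideanSpace ℝ (Fin N) → ℝ) :
    Qform x₀ θ i (fundSol x₀) v = (θ ^ (N - 1) * omegaN N)⁻¹ *
      ∫ x in sphere x₀ θ, fderiv ℝ v x (EuclideanSpace.single i 1) ∂μH[(N : ℝ) - 1] := by
  have hθN : θ ^ N = θ ^ (N - 1) * θ := by rw [← pow_succ]; congr 1; omega
  have hω := omegaN_pos (N := N) (by omega)
  have hfd : ∀ x ∈ sphere x₀ θ, fderiv ℝ (fundSol x₀) x =
      -(omegaN N * θ ^ N)⁻¹ • innerSL ℝ (x - x₀) := by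
    intro x hx
    have hx' : ‖x - x₀‖ = θ := by simpa [dist_eq_norm] using hx
    have hne : x ≠ x₀ := by
      rintro rfl
      simp [hθ.ne] at hx'
    rw [(hasFDerivAt_fundSol hN hne).fderiv, hx']
  have hmeas : MeasurableSet (sphere x₀ θ) := isClosed_sphere.measurableSet
  have hcancel : ∫ x in sphere x₀ θ, ⟪gradient v x, θ⁻¹ • (x - x₀)⟫ *
        fderiv ℝ (fundSol x₀) x (EuclideanSpace.single i 1) ∂μH[(N : ℝ) - 1] =
      ∫ x in sphere x₀ θ, ⟪gradient (fundSol x₀) x, gradient v x⟫ * ((x - x₀) i / θ)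
        ∂μH[(N : ℝ) - 1] := by
    refine setIntegral_congr_fun hmeas fun x hx => ?_
    simp only [inner_gradient_left, hfd x hx]
    rw [smul_apply, smul_apply, innerSL_apply_apply,
      innerSL_apply_apply, inner_gradient_right, EuclideanSpace.inner_single_right]
    simp
    ring
  have hflux : ∫ x in sphere x₀ θ, ⟪gradient (fundSol x₀) x, θ⁻¹ • (x - x₀)⟫ *
        fderiv ℝ v x (EuclideanSpace.single i 1) ∂μH[(N : ℝ) - 1] =
      -(θ ^ (N - 1) * omegaN N)⁻¹ *
        ∫ x in sphere x₀ θ, fderiv ℝ v x (EuclideanSpace.single i 1) ∂μH[(N : ℝ) - 1] := by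
    rw [← integral_const_mul]
    refine setIntegral_congr_fun hmeas fun x hx => ?_
    have hx' : ‖x - x₀‖ = θ := by simpa [dist_eq_norm] using hx
    simp only [inner_gradient_left, hfd x hx]
    rw [smul_apply, innerSL_apply_apply, inner_smul_right,
      real_inner_self_eq_norm_sq, hx', hθN, smul_eq_mul]
    congr 1
    field_simp
  rw [Qform, hcancel, hflux]
  ring

/-- If `Φ` is `C¹` on an open neighborhood of `x₀`, then
`Q_{θ,i}(S_{x₀}, Φ) → (∂Φ/∂x_i)(x₀)` as `θ → 0⁺`. -/
theorem Qform_fundSol_smooth_limit {N : ℕ} (hN : 3 ≤ N)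
    (x₀ : EuclideanSpace ℝ (Fin N)) (i : Fin N) (Φ : EuclideanSpace ℝ (Fin N) → ℝ)
    (V : Set (EuclideanSpace ℝ (Fin N))) (hV : IsOpen V) (hx₀ : x₀ ∈ V)
    (hΦ : ContDiffOn ℝ 1 Φ V) :
    Filter.Tendsto (fun θ : ℝ => Qform x₀ θ i (fundSol x₀) Φ)
      (nhdsWithin 0 (Set.Ioi 0))
      (nhds (fderiv ℝ Φ x₀ (EuclideanSpace.single i 1))) := by
  rw [Metric.tendsto_nhds]
  intro ε hε
  have hcont : ContinuousOn (fun x => fderiv ℝ Φ x (EuclideanSpace.single i 1)) V :=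
    (hΦ.continuousOn_fderiv_of_isOpen hV le_rfl).clm_apply continuousOn_const
  have hnear := (hcont.continuousAt (hV.mem_nhds hx₀)).eventually
    (Metric.ball_mem_nhds _ (half_pos hε))
  obtain ⟨δ, hδ, hball⟩ := Metric.eventually_nhds_iff.1 (hnear.and (hV.mem_nhds hx₀))
  filter_upwards [Ioo_mem_nhdsGT hδ] with θ ⟨hθ, hθδ⟩
  have hsphere : ∀ x ∈ sphere x₀ θ, dist x x₀ < δ := fun x hx => (mem_sphere.1 hx).trans_lt hθδ
  have hpos : 0 < θ ^ (N - 1) * omegaN N := mul_pos (pow_pos hθ _) (omegaN_pos (by omega))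
  have hμ := hausdorffMeasure_sphere (by omega) x₀ hθ
  have hfin : μH[(N : ℝ) - 1] (sphere x₀ θ) < ∞ := hμ ▸ ENNReal.ofReal_lt_top
  have hreal : (μH[(N : ℝ) - 1]).real (sphere x₀ θ) = θ ^ (N - 1) * omegaN N := by
    rw [Measure.real, hμ, ENNReal.toReal_ofReal hpos.le]
  have hint : IntegrableOn (fun x => fderiv ℝ Φ x (EuclideanSpace.single i 1)) (sphere x₀ θ)
      μH[(N : ℝ) - 1] :=
    (hcont.mono fun x hx => (hball (hsphere x hx)).2).integrableOn_of_subset_isCompact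
      (isCompact_sphere x₀ θ) isClosed_sphere.measurableSet subset_rfl hfin.ne
  have hbound := norm_setIntegral_le_of_norm_le_const hfin
    (f := fun x => fderiv ℝ Φ x (EuclideanSpace.single i 1) -
      fderiv ℝ Φ x₀ (EuclideanSpace.single i 1)) (C := ε / 2)
    fun x hx => (mem_ball_iff_norm.1 (hball (hsphere x hx)).1).le
  rw [integral_sub hint (integrableOn_const hfin.ne), setIntegral_const, hreal, smul_eq_mul]
    at hbound
  rw [Qform_fundSol_eq_mean hN x₀ hθ, Real.dist_eq]
  refine lt_of_le_of_lt ?_ (half_lt_self hε)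
  refine le_of_mul_le_mul_left (le_of_eq_of_le ?_ (hbound.trans_eq (mul_comm _ _))) hpos
  rw [Real.norm_eq_abs, ← abs_of_pos hpos, ← abs_mul, abs_of_pos hpos, mul_sub,
    mul_inv_cancel_left₀ hpos.ne']
end
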